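/- Let T be a finite tree whose vertices are colored black or white, and let i be fixed. If T contains a connected subgraph on i vertices with exactly j₁ black vertices and a connected subgraph on i vertices with exactly j₂ black vertices, where j₁ ≤ j₂, then for every j with j₁ ≤ j ≤ j₂, T contains a connected subgraph on i vertices with exactly j black vertices. -/

import Mathlib

namespace SimpleGraph

variable {V : Type*} {G : SimpleGraph V}

lemma connected_induce_singleton (v : V) :
    (G.induce (↑({v} : Finset V) : Set V)).Connected := by
  rw [Finset.coe_singleton]
  have : Nonempty ({v} : Set V) := ⟨⟨v, rfl⟩⟩
  exact ⟨Preconnected.of_subsingleton⟩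

lemma Connected.exists_adj_of_ssubset {C W : Finset V}
    (hW : (G.induce (↑W : Set V)).Connected) (hC : C.Nonempty) (hCW : C ⊂ W) :
    ∃ c ∈ C, ∃ y ∈ W, y ∉ C ∧ G.Adj c y := by
  obtain ⟨c, hc⟩ := hC
  obtain ⟨w, hw, hwC⟩ := Finset.exists_of_ssubset hCW
  obtain ⟨p⟩ := hW.preconnected ⟨c, hCW.1 hc⟩ ⟨w, hw⟩
  obtain ⟨d, -, hd₁, hd₂⟩ := p.exists_boundary_dart {v | v.1 ∈ C} hc hwC
  exact ⟨d.fst, hd₁, d.snd, d.snd.2, hd₂, d.adj⟩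

variable [DecidableEq V]

/-- Two finite vertex sets inducing connected subgraphs that differ by exchanging one vertex. -/
def IsConnectedExchange (G : SimpleGraph V) (A B : Finset V) : Prop :=
  (G.induce (↑A : Set V)).Connected ∧ (G.induce (↑B : Set V)).Connected ∧
    ∃ x ∈ A, ∃ y ∉ A, B = insert y (A.erase x)

lemma Connected.induce_insert {s : Finset V} (hs : (G.induce (↑s : Set V)).Connected)
    {u y : V} (hu : u ∈ s) (h : G.Adj u y) :
    (G.induce (↑(insert y s) : Set V)).Connected := by
  have := induce_union_connected hs.preconnected (induce_pair_connected_of_adj h).preconnected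
    ⟨u, by simpa using hu, by simp⟩
  have e : (↑(insert y s) : Set V) = ↑s ∪ {u, y} := by
    ext v
    simp only [Finset.coe_insert, Set.mem_insert_iff, Set.mem_union, Finset.mem_coe,
      Set.mem_singleton_iff]
    grind
  rwa [e]

lemma Connected.exists_connected_erase {C U : Finset V}
    (hU : (G.induce (↑U : Set V)).Connected) (hC : (G.induce (↑C : Set V)).Connected)
    (hCU : C ⊂ U) :
    ∃ x ∈ U, x ∉ C ∧ (G.induce (↑(U.erase x) : Set V)).Connected := by
  induction hn : U.card - C.card generalizing C with
  | zero => have := Finset.card_lt_card hCU; omega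
  | succ n ih =>
    have hne : C.Nonempty := by
      obtain ⟨v⟩ := hC.nonempty
      exact ⟨v, v.2⟩
    obtain ⟨c, hc, y, hyU, hyC, hadj⟩ := hU.exists_adj_of_ssubset hne hCU
    by_cases h : insert y C = U
    · exact ⟨y, hyU, hyC, by rwa [← h, Finset.erase_insert hyC]⟩
    · obtain ⟨x, hxU, hx, hconn⟩ := ih (hC.induce_insert hc hadj)
        ((Finset.insert_subset hyU hCU.1).ssubset_of_ne h)
        (by rw [Finset.card_insert_of_notMem hyC]; omega)
      exact ⟨x, hxU, fun hxC => hx (Finset.mem_insert_of_mem hxC), hconn⟩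

lemma Connected.isConnectedExchange {U : Finset V} (hU : (G.induce (↑U : Set V)).Connected)
    {c x y : V} (hx : x ∈ U) (hcx : c ≠ x) (hc : c ∈ U) (hy : y ∉ U) (h : G.Adj c y)
    (hconn : (G.induce (↑(U.erase x) : Set V)).Connected) :
    IsConnectedExchange G U (insert y (U.erase x)) :=
  ⟨hU, hconn.induce_insert (Finset.mem_erase.2 ⟨hcx, hc⟩) h, x, hx, y, hy, rfl⟩

lemma IsConnectedExchange.card_eq {A B : Finset V} (h : IsConnectedExchange G A B) :
    B.card = A.card := by
  obtain ⟨-, -, x, hx, y, hy, rfl⟩ := h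
  rw [Finset.card_insert_of_notMem (fun h => hy (Finset.mem_of_mem_erase h)),
    Finset.card_erase_add_one hx]

lemma IsConnectedExchange.card_filter_le {A B : Finset V} (h : IsConnectedExchange G A B)
    (p : V → Prop) [DecidablePred p] : (B.filter p).card ≤ (A.filter p).card + 1 := by
  obtain ⟨-, -, x, hx, y, hy, rfl⟩ := h
  calc _ ≤ (insert y (A.filter p)).card := Finset.card_le_card (by intro; simp; grind)
    _ ≤ _ := Finset.card_insert_le _ _

lemma Connected.reflTransGen_isConnectedExchange_of_subset {C U W : Finset V}
    (hU : (G.induce (↑U : Set V)).Connected) (hW : (G.induce (↑W : Set V)).Connected)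
    (hC : (G.induce (↑C : Set V)).Connected) (hCU : C ⊆ U) (hCW : C ⊆ W)
    (hcard : U.card = W.card) :
    Relation.ReflTransGen (IsConnectedExchange G) U W := by
  induction hn : W.card - C.card generalizing C U with
  | zero =>
    rw [← Finset.eq_of_subset_of_card_le hCU (by omega),
      ← Finset.eq_of_subset_of_card_le hCW (by omega)]
  | succ n ih =>
    have hne : C.Nonempty := by
      obtain ⟨v⟩ := hC.nonempty
      exact ⟨v, v.2⟩
    obtain ⟨c, hc, y, hyW, hyC, hadj⟩ := hW.exists_adj_of_ssubset hne
      (hCW.ssubset_of_ne (by rintro rfl; omega))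
    have hC' := hC.induce_insert hc hadj
    have hn' : W.card - (insert y C).card = n := by
      rw [Finset.card_insert_of_notMem hyC]; omega
    by_cases hyU : y ∈ U
    · exact ih hU hC' (Finset.insert_subset hyU hCU) (Finset.insert_subset hyW hCW) hcard hn'
    · obtain ⟨x, hxU, hxC, hconn⟩ := hU.exists_connected_erase hC
        (hCU.ssubset_of_ne (by rintro rfl; omega))
      have hex := hU.isConnectedExchange hxU (ne_of_mem_of_not_mem hc hxC) (hCU hc) hyU hadj hconn
      refine .head hex (ih hex.2.1 hC' ?_ (Finset.insert_subset hyW hCW)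
        (hex.card_eq.trans hcard) hn')
      exact Finset.insert_subset_insert _ (Finset.subset_erase.2 ⟨hCU, hxC⟩)

lemma Connected.exists_reflTransGen_isConnectedExchange_mem_of_adj {U : Finset V}
    (hU : (G.induce (↑U : Set V)).Connected) {u v : V} (hu : u ∈ U) (h : G.Adj u v) :
    ∃ U' : Finset V, (G.induce (↑U' : Set V)).Connected ∧ v ∈ U' ∧
      Relation.ReflTransGen (IsConnectedExchange G) U U' := by
  by_cases hv : v ∈ U
  · exact ⟨U, hU, hv, .refl⟩
  by_cases hs : {u} = U
  · subst hs
    have hex : IsConnectedExchange G {u} {v} :=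
      ⟨hU, connected_induce_singleton v, u, hu, v, hv, by simp⟩
    exact ⟨{v}, hex.2.1, Finset.mem_singleton_self v, .single hex⟩
  · obtain ⟨x, hxU, hxu, hconn⟩ := hU.exists_connected_erase (connected_induce_singleton u)
      ((Finset.singleton_subset_iff.2 hu).ssubset_of_ne hs)
    have hex := hU.isConnectedExchange hxU
      (ne_of_mem_of_not_mem (Finset.mem_singleton_self u) hxu) hu hv h hconn
    exact ⟨_, hex.2.1, Finset.mem_insert_self _ _, .single hex⟩

lemma Walk.exists_reflTransGen_isConnectedExchange_mem {u v : V} (p : G.Walk u v) {U : Finset V}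
    (hU : (G.induce (↑U : Set V)).Connected) (hu : u ∈ U) :
    ∃ U' : Finset V, (G.induce (↑U' : Set V)).Connected ∧ v ∈ U' ∧
      Relation.ReflTransGen (IsConnectedExchange G) U U' := by
  induction p generalizing U with
  | nil => exact ⟨U, hU, hu, .refl⟩
  | cons h _ ih =>
    obtain ⟨U₁, hU₁, hv₁, hr₁⟩ := hU.exists_reflTransGen_isConnectedExchange_mem_of_adj hu h
    obtain ⟨U₂, hU₂, hv₂, hr₂⟩ := ih hU₁ hv₁
    exact ⟨U₂, hU₂, hv₂, hr₁.trans hr₂⟩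

lemma card_eq_of_reflTransGen_isConnectedExchange {U W : Finset V}
    (h : Relation.ReflTransGen (IsConnectedExchange G) U W) : W.card = U.card := by
  induction h with
  | refl => rfl
  | tail _ h ih => exact h.card_eq.trans ih

/-- In a connected graph, any two finite connected vertex sets of the same size are joined by
a sequence of single-vertex exchanges through connected vertex sets. -/
theorem Connected.reflTransGen_isConnectedExchange (hG : G.Connected) {U W : Finset V}
    (hU : (G.induce (↑U : Set V)).Connected) (hW : (G.induce (↑W : Set V)).Connected)
    (hcard : U.card = W.card) :
    Relation.ReflTransGen (IsConnectedExchange G) U W := by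
  obtain ⟨u, hu⟩ := hU.nonempty
  obtain ⟨w, hw⟩ := hW.nonempty
  obtain ⟨p⟩ := hG.preconnected u w
  obtain ⟨U', hU', hwU', hr⟩ := p.exists_reflTransGen_isConnectedExchange_mem hU hu
  exact hr.trans (hU'.reflTransGen_isConnectedExchange_of_subset hW (connected_induce_singleton w)
    (Finset.singleton_subset_iff.2 hwU') (Finset.singleton_subset_iff.2 hw)
    ((card_eq_of_reflTransGen_isConnectedExchange hr).trans hcard))

lemma exists_card_filter_eq_of_reflTransGen_isConnectedExchange {U W : Finset V}
    (h : Relation.ReflTransGen (IsConnectedExchange G) U W)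
    (hW : (G.induce (↑W : Set V)).Connected) (p : V → Prop) [DecidablePred p] {j : ℕ}
    (hj₁ : (U.filter p).card ≤ j) (hj₂ : j ≤ (W.filter p).card) :
    ∃ A : Finset V, A.card = W.card ∧ (G.induce (↑A : Set V)).Connected ∧
      (A.filter p).card = j := by
  induction h using Relation.ReflTransGen.head_induction_on with
  | refl => exact ⟨W, rfl, hW, le_antisymm hj₁ hj₂⟩
  | @head A B hAB hBW ih =>
    obtain hlt | rfl := hj₁.lt_or_eq
    · exact ih ((hAB.card_filter_le p).trans hlt)
    · exact ⟨A, (card_eq_of_reflTransGen_isConnectedExchange (.head hAB hBW)).symm, hAB.1, rfl⟩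

end SimpleGraph

/-- Interval property for binary jumbled pattern matching on trees
(Lemma 2 of the paper): if a black/white colored tree `G` contains a
connected subgraph on `i` vertices with `j₁` black vertices and one with
`j₂` black vertices, `j₁ ≤ j₂`, then for every `j₁ ≤ j ≤ j₂` it contains
a connected subgraph on `i` vertices with exactly `j` black vertices.
Here `col v = true` means `v` is black. -/
theorem tree_jumbled_interval_property {V : Type*} [Fintype V] [DecidableEq V]
    (G : SimpleGraph V) (hconn : G.Connected) (hacyc : G.IsAcyclic)
    (col : V → Bool) (i j₁ j₂ : ℕ)
    (h₁ : ∃ U : Finset V, U.card = i ∧ (G.induce (↑U : Set V)).Connected ∧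
      (U.filter fun v => col v).card = j₁)
    (h₂ : ∃ U : Finset V, U.card = i ∧ (G.induce (↑U : Set V)).Connected ∧
      (U.filter fun v => col v).card = j₂)
    (hle : j₁ ≤ j₂) :
    ∀ j : ℕ, j₁ ≤ j → j ≤ j₂ →
      ∃ U : Finset V, U.card = i ∧ (G.induce (↑U : Set V)).Connected ∧
        (U.filter fun v => col v).card = j := by
  obtain ⟨U, hUi, hU, rfl⟩ := h₁
  obtain ⟨W, rfl, hW, rfl⟩ := h₂
  intro j hj₁ hj₂
  exact SimpleGraph.exists_card_filter_eq_of_reflTransGen_isConnectedExchange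
    (hconn.reflTransGen_isConnectedExchange hU hW hUi) hW _ hj₁ hj₂
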